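/- Let X, X₁, …, Xₙ be i.i.d. real-valued random variables, let τ > 0 with M(τ) > 0, and let a = (a₁, …, aₙ) with aₖ ∈ ℝ^d be such that 𝑁 = Σₖ aₖaₖᵀ is positive definite. Let D > 0 and α > 0, and suppose Σₖ(⟨t,aₖ⟩ − mₖ)² ≥ α² for all integers m₁, …, mₙ and all t ∈ ℝ^d with ‖t‖ ≤ D and maxₖ|⟨t,aₖ⟩| ≥ 1/2. Then there exist absolute constants c₁, c₂ > 0 such that Q(F_a, dτ/D) ≤ c₁^d ( (√d/(D √M(τ)))^d (det 𝑁)^{-1/2} + exp(−c₂ α² M(τ)) ). -/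

import Mathlib

open MeasureTheory
open scoped RealInnerProductSpace

/-- Concentration function `Q(μ, r) = sup_x μ(x + rB)` of a measure on `ℝ^d`. -/
noncomputable def concFn {d : ℕ} (μ : Measure (EuclideanSpace ℝ (Fin d))) (r : ℝ) : ℝ :=
  ⨆ x : EuclideanSpace ℝ (Fin d), (μ (Metric.closedBall x r)).toReal

/-- Law of `S_a = ∑ k, X_k • a_k`, where `X_1, …, X_n` are i.i.d. with law `ν`. -/
noncomputable def sumLaw {d n : ℕ} (ν : Measure ℝ) (a : Fin n → EuclideanSpace ℝ (Fin d)) :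
    Measure (EuclideanSpace ℝ (Fin d)) :=
  (Measure.pi fun _ : Fin n => ν).map (fun ω => ∑ k, ω k • a k)

/-- `M(τ) = E min(X̃²/τ², 1)`, where `X̃ = X₁ - X₂` with `X₁, X₂` i.i.d. of law `ν`. -/
noncomputable def Mfn (ν : Measure ℝ) (τ : ℝ) : ℝ :=
  ∫ p : ℝ × ℝ, min ((p.1 - p.2) ^ 2 / τ ^ 2) 1 ∂(ν.prod ν)

/-- The matrix `𝑁 = ∑ k, aₖ aₖᵀ`. -/
noncomputable def covMat {d n : ℕ} (a : Fin n → EuclideanSpace ℝ (Fin d)) :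
    Matrix (Fin d) (Fin d) ℝ :=
  Matrix.of fun i j => ∑ k, a k i * a k j

/-- The squared triangle function, a compactly supported kernel on the line. -/
noncomputable def triSq (s : ℝ) : ℝ := (max (1 - |s|) 0) ^ 2

/-- The Fourier transform of `triSq`. -/
noncomputable def triSqHat (x : ℝ) : ℝ := ∫ s, triSq s * Real.cos (s * x)

lemma triSq_nonneg (s : ℝ) : 0 ≤ triSq s := by unfold triSq; positivity

lemma triSq_le_one (s : ℝ) : triSq s ≤ 1 := by
  unfold triSq
  have h : max (1 - |s|) 0 ≤ 1 := max_le (by linarith [abs_nonneg s]) zero_le_one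
  exact pow_le_one₀ (le_max_right _ _) h

lemma triSq_eq_zero {s : ℝ} (hs : 1 ≤ |s|) : triSq s = 0 := by
  unfold triSq
  rw [max_eq_right (by linarith)]
  norm_num

lemma continuous_triSq : Continuous triSq := by unfold triSq; fun_prop

lemma integrable_triSq : Integrable triSq := by
  refine continuous_triSq.integrable_of_hasCompactSupport ?_
  refine HasCompactSupport.of_support_subset_isCompact (isCompact_Icc (a := (-1 : ℝ)) (b := 1)) ?_
  intro s hs
  by_contra h
  refine hs (triSq_eq_zero ?_)
  by_contra! h'
  exact h ⟨(abs_lt.1 h').1.le, (abs_lt.1 h').2.le⟩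

lemma triSqHat_eq_intervalIntegral (x : ℝ) :
    triSqHat x = 2 * ∫ s in (0 : ℝ)..1, (1 - s) ^ 2 * Real.cos (s * x) := by
  have h1 : ∀ s : ℝ, triSq s * Real.cos (s * x)
      = (fun t : ℝ => (max (1 - t) 0) ^ 2 * Real.cos (t * x)) |s| := by
    intro s
    simp only [triSq]
    congr 1
    rcases abs_choice s with h | h <;> rw [h]
    rw [neg_mul, Real.cos_neg]
  unfold triSqHat
  simp_rw [h1]
  rw [integral_comp_abs (f := fun t : ℝ => (max (1 - t) 0) ^ 2 * Real.cos (t * x))]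
  congr 1
  rw [intervalIntegral.integral_of_le zero_le_one]
  rw [setIntegral_eq_of_subset_of_forall_sdiff_eq_zero measurableSet_Ioi
    (Set.Ioc_subset_Ioi_self : Set.Ioc (0 : ℝ) 1 ⊆ _)]
  · refine setIntegral_congr_fun measurableSet_Ioc fun s hs => ?_
    rw [max_eq_left (by linarith [hs.2])]
  · intro s hs
    have h0 : ¬ s ≤ 1 := fun h => hs.2 ⟨hs.1, h⟩
    rw [max_eq_right (by linarith)]
    norm_num

lemma triSqHat_zero : triSqHat 0 = 2 / 3 := by
  rw [triSqHat_eq_intervalIntegral]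
  simp only [mul_zero, Real.cos_zero, mul_one]
  rw [intervalIntegral.integral_comp_sub_left (fun s => s ^ 2) (1 : ℝ)]
  norm_num

lemma triSqHat_of_ne_zero {x : ℝ} (hx : x ≠ 0) :
    triSqHat x = 4 * (x - Real.sin x) / x ^ 3 := by
  rw [triSqHat_eq_intervalIntegral]
  have hd : ∀ s ∈ Set.uIcc (0 : ℝ) 1, HasDerivAt
      (fun s : ℝ => (1 - s) ^ 2 * Real.sin (s * x) / x - 2 * (1 - s) * Real.cos (s * x) / x ^ 2
        - 2 * Real.sin (s * x) / x ^ 3) ((1 - s) ^ 2 * Real.cos (s * x)) s := by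
    intro s _
    have hl : HasDerivAt (fun s : ℝ => 1 - s) (-1) s := by
      simpa using (hasDerivAt_id s).const_sub 1
    have hm : HasDerivAt (fun s : ℝ => s * x) x s := by
      simpa using (hasDerivAt_id s).mul_const x
    have h := ((((hl.pow 2).mul hm.sin).div_const x).sub
      (((hl.const_mul 2).mul hm.cos).div_const (x ^ 2))).sub
      ((hm.sin.const_mul 2).div_const (x ^ 3))
    refine h.congr_deriv ?_
    field_simp
    simp
    ring
  rw [intervalIntegral.integral_eq_sub_of_hasDerivAt hd
    (Continuous.intervalIntegrable (by fun_prop) _ _)]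
  simp only [sub_self, one_mul, zero_mul, Real.sin_zero, Real.cos_zero, sub_zero]
  field_simp
  ring

lemma triSqHat_neg (x : ℝ) : triSqHat (-x) = triSqHat x := by
  simp [triSqHat]

lemma triSqHat_bounds (x : ℝ) :
    1 / 5 / (1 + x ^ 2) ≤ triSqHat x ∧ triSqHat x ≤ 16 / (1 + x ^ 2) := by
  wlog hx : 0 ≤ x with H
  · have := H (-x) (by linarith)
    rwa [triSqHat_neg, neg_sq] at this
  rcases hx.eq_or_lt with rfl | hx
  · rw [triSqHat_zero]; norm_num
  rw [triSqHat_of_ne_zero hx.ne', div_le_div_iff₀ (by positivity) (by positivity),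
    div_le_div_iff₀ (by positivity) (by positivity)]
  rcases le_total x 1 with h1 | h1
  · have hb := abs_le.1 (Real.sin_bound (x := x) (by rwa [abs_of_pos hx]))
    rw [abs_of_pos hx] at hb
    have h5 : x ^ 5 ≤ x ^ 3 := pow_le_pow_of_le_one hx.le h1 (by norm_num)
    have h3 : 0 < x ^ 3 := by positivity
    have ha : x ^ 3 / 10 ≤ x - Real.sin x := by linarith
    have hc : x - Real.sin x ≤ x ^ 3 := by linarith
    constructor
    · nlinarith [sq_nonneg x]
    · nlinarith [sq_nonneg x, mul_nonneg h3.le (sq_nonneg x)]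
  · have hlow : x / 20 ≤ x - Real.sin x := by
      rcases le_total x 2 with h2 | h2
      · have hb := abs_le.1 (Real.sin_bound (x := 1) (by norm_num))
        norm_num at hb
        have := (abs_le.1 (Real.abs_sin_sub_sin_le x 1)).2
        rw [abs_of_nonneg (by linarith)] at this
        linarith
      · linarith [Real.sin_le_one x]
    have hup : x - Real.sin x ≤ 2 * x := by linarith [Real.neg_one_le_sin x]
    have hx2 : 1 ≤ x ^ 2 := one_le_pow₀ h1
    constructor
    · nlinarith [mul_le_mul_of_nonneg_right hlow (by positivity : 0 ≤ 1 + x ^ 2)]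
    · nlinarith [mul_le_mul_of_nonneg_right hup (by positivity : 0 ≤ 1 + x ^ 2)]

lemma triSqHat_pos (x : ℝ) : 0 < triSqHat x :=
  lt_of_lt_of_le (by positivity) (triSqHat_bounds x).1

lemma triSqHat_mul_le {z : ℝ} (hz : 1 ≤ z) (x : ℝ) : triSqHat (z * x) ≤ 80 * triSqHat x := by
  have h1 := (triSqHat_bounds (z * x)).2
  have h2 := (triSqHat_bounds x).1
  have h3 : 16 / (1 + (z * x) ^ 2) ≤ 16 / (1 + x ^ 2) := by
    have : 1 ≤ z ^ 2 := one_le_pow₀ hz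
    refine div_le_div_of_nonneg_left (by norm_num) (by positivity) ?_
    rw [mul_pow]
    nlinarith [sq_nonneg x]
  have h4 : 16 / (1 + x ^ 2) = 80 * (1 / 5 / (1 + x ^ 2)) := by ring
  linarith

/-- The measure on `ℝ^d` whose density is the tensor power of `triSq`. -/
noncomputable def triMeasure (d : ℕ) : Measure (Fin d → ℝ) :=
  volume.withDensity fun s => ENNReal.ofReal (∏ i, triSq (s i))

lemma measurable_prod_triSq (d : ℕ) : Measurable fun s : Fin d → ℝ => ∏ i, triSq (s i) := by
  have := continuous_triSq
  exact Continuous.measurable (by fun_prop)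

lemma integral_triMeasure {d : ℕ} (f : (Fin d → ℝ) → ℝ) :
    ∫ s, f s ∂triMeasure d = ∫ s, (∏ i, triSq (s i)) * f s := by
  unfold triMeasure
  rw [integral_withDensity_eq_integral_toReal_smul (measurable_prod_triSq d).ennreal_ofReal
    (by simp)]
  refine integral_congr_ae (ae_of_all _ fun s => ?_)
  simp only [smul_eq_mul]
  rw [ENNReal.toReal_ofReal (Finset.prod_nonneg fun i _ => triSq_nonneg _)]

lemma triMeasure_le_volume (d : ℕ) : triMeasure d ≤ volume := by
  unfold triMeasure
  conv_rhs => rw [← withDensity_one (μ := (volume : Measure (Fin d → ℝ)))]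
  refine withDensity_mono (ae_of_all _ fun s => ?_)
  simp only [Pi.one_apply, ENNReal.ofReal_le_one]
  exact Finset.prod_le_one (fun i _ => triSq_nonneg _) fun i _ => triSq_le_one _

lemma integral_exp_triSq (x : ℝ) :
    ∫ s, (triSq s : ℂ) * Complex.exp ((s * x : ℝ) * Complex.I) = (triSqHat x : ℂ) := by
  have hint : Integrable fun s => (triSq s : ℂ) * Complex.exp ((s * x : ℝ) * Complex.I) := by
    refine integrable_triSq.ofReal.mul_bdd (c := 1) ?_ ?_
    · exact (Continuous.aestronglyMeasurable (by fun_prop))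
    · exact ae_of_all _ fun s => (Complex.norm_exp_ofReal_mul_I _).le
  apply Complex.ext
  · rw [← RCLike.re_eq_complex_re, ← integral_re hint]
    simp [triSqHat, Complex.exp_ofReal_mul_I_re, -Complex.ofReal_mul]
  · rw [← RCLike.im_eq_complex_im, ← integral_im hint]
    simp only [RCLike.im_eq_complex_im, Complex.im_ofReal_mul, Complex.exp_ofReal_mul_I_im,
      Complex.ofReal_im]
    have h := integral_neg_eq_self (fun s : ℝ => triSq s * Real.sin (s * x)) volume
    simp only [triSq, abs_neg, neg_mul, Real.sin_neg, mul_neg, integral_neg] at h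
    simp only [triSq]
    linarith

lemma integral_cos_triMeasure {d : ℕ} (w : Fin d → ℝ) :
    ∫ s, Real.cos (∑ i, s i * w i) ∂triMeasure d = ∏ i, triSqHat (w i) := by
  have hp : ∀ s : Fin d → ℝ,
      ∏ i, ((triSq (s i) : ℂ) * Complex.exp ((s i * w i : ℝ) * Complex.I))
        = ((∏ i, triSq (s i) : ℝ) : ℂ) * Complex.exp ((∑ i, s i * w i : ℝ) * Complex.I) := by
    intro s
    rw [Finset.prod_mul_distrib, ← Complex.exp_sum, ← Finset.sum_mul]
    push_cast
    rfl
  have h := integral_fintype_prod_volume_eq_prod (𝕜 := ℂ)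
    (fun (i : Fin d) (t : ℝ) => (triSq t : ℂ) * Complex.exp ((t * w i : ℝ) * Complex.I))
  simp only [integral_exp_triSq, hp] at h
  have hint : Integrable fun s : Fin d → ℝ =>
      ((∏ i, triSq (s i) : ℝ) : ℂ) * Complex.exp ((∑ i, s i * w i : ℝ) * Complex.I) := by
    refine (Integrable.ofReal (Integrable.fintype_prod (fun _ => integrable_triSq))).mul_bdd
      (c := 1) ?_ ?_
    · exact (Continuous.aestronglyMeasurable (by fun_prop))
    · exact ae_of_all _ fun s => (Complex.norm_exp_ofReal_mul_I _).le
  have h2 := congrArg Complex.re h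
  rw [← RCLike.re_eq_complex_re, ← integral_re hint] at h2
  simp only [RCLike.re_eq_complex_re, Complex.re_ofReal_mul, Complex.exp_ofReal_mul_I_re,
    ← Complex.ofReal_prod, Complex.ofReal_re] at h2
  rw [integral_triMeasure, h2]

instance isFiniteMeasure_triMeasure (d : ℕ) : IsFiniteMeasure (triMeasure d) := by
  refine isFiniteMeasure_withDensity_ofReal ?_
  exact (Integrable.fintype_prod (fun _ : Fin d => integrable_triSq)).2

lemma triMeasure_univ_le_one (d : ℕ) : (triMeasure d).real Set.univ ≤ 1 := by
  have h := integral_cos_triMeasure (d := d) 0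
  simp only [Pi.zero_apply, mul_zero, Finset.sum_const_zero, Real.cos_zero, integral_const,
    smul_eq_mul, mul_one, triSqHat_zero, Finset.prod_const] at h
  rw [h]
  exact pow_le_one₀ (by norm_num) (by norm_num)

lemma ae_triMeasure_abs_le_one (d : ℕ) : ∀ᵐ s ∂triMeasure d, ∀ i, |s i| ≤ 1 := by
  unfold triMeasure
  rw [ae_withDensity_iff (measurable_prod_triSq d).ennreal_ofReal]
  refine ae_of_all _ fun s hs i => ?_
  by_contra! h
  refine hs ?_
  rw [Finset.prod_eq_zero (Finset.mem_univ i) (triSq_eq_zero h.le), ENNReal.ofReal_zero]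

/-- `f` is a bounded continuous function for which dilation by `z` increases the integrals of `f`
against all characters by a factor of at most `C`. -/
structure DilationBounded {d : ℕ} (z C : ℝ) (f : (Fin d → ℝ) → ℝ) : Prop where
  cont : Continuous f
  bdd : ∃ B, ∀ s, |f s| ≤ B
  le : ∀ w : Fin d → ℝ,
    ∫ s, f (z • s) * Real.cos (∑ i, (z • s) i * w i) ∂triMeasure d ≤
      C * ∫ s, f s * Real.cos (∑ i, s i * w i) ∂triMeasure d

lemma integrable_triMeasure_of_bdd {d : ℕ} {f : (Fin d → ℝ) → ℝ} (hf : Continuous f) {B : ℝ}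
    (hB : ∀ s, |f s| ≤ B) : Integrable f (triMeasure d) :=
  Integrable.of_bound hf.aestronglyMeasurable B (ae_of_all _ hB)

namespace DilationBounded

variable {d : ℕ} {z C : ℝ} {f g : (Fin d → ℝ) → ℝ}

lemma one (hz : 1 ≤ z) : DilationBounded z (80 ^ d) (fun _ : Fin d → ℝ => (1 : ℝ)) where
  cont := continuous_const
  bdd := ⟨1, fun _ => by simp⟩
  le w := by
    have h : ∀ s : Fin d → ℝ, ∑ i, (z • s) i * w i = ∑ i, s i * (z * w i) := fun s =>
      Finset.sum_congr rfl fun i _ => by simp only [Pi.smul_apply, smul_eq_mul]; ring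
    simp only [one_mul, h]
    rw [integral_cos_triMeasure, integral_cos_triMeasure]
    calc ∏ i, triSqHat (z * w i) ≤ ∏ i, (80 * triSqHat (w i)) :=
          Finset.prod_le_prod (fun i _ => (triSqHat_pos _).le) fun i _ => triSqHat_mul_le hz _
      _ = 80 ^ d * ∏ i, triSqHat (w i) := by simp [Finset.prod_mul_distrib]

lemma integrable (hf : DilationBounded z C f) (c : ℝ) (w : Fin d → ℝ) :
    Integrable (fun s => f (c • s) * Real.cos (∑ i, (c • s) i * w i)) (triMeasure d) := by
  obtain ⟨B, hB⟩ := hf.bdd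
  have := hf.cont
  refine integrable_triMeasure_of_bdd (by fun_prop) (B := B * 1) fun s => ?_
  rw [abs_mul]
  exact mul_le_mul (hB _) (Real.abs_cos_le_one _) (abs_nonneg _) ((abs_nonneg _).trans (hB 0))

lemma integrable' (hf : DilationBounded z C f) (w : Fin d → ℝ) :
    Integrable (fun s => f s * Real.cos (∑ i, s i * w i)) (triMeasure d) := by
  simpa using hf.integrable 1 w

lemma add (hf : DilationBounded z C f) (hg : DilationBounded z C g) :
    DilationBounded z C (fun s => f s + g s) where
  cont := hf.cont.add hg.cont
  bdd := by
    obtain ⟨A, hA⟩ := hf.bdd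
    obtain ⟨B, hB⟩ := hg.bdd
    exact ⟨A + B, fun s => (abs_add_le _ _).trans (add_le_add (hA s) (hB s))⟩
  le w := by
    simp only [add_mul]
    rw [integral_add (hf.integrable z w) (hg.integrable z w),
      integral_add (hf.integrable' w) (hg.integrable' w), mul_add]
    exact add_le_add (hf.le w) (hg.le w)

lemma const_mul (hf : DilationBounded z C f) {c : ℝ} (hc : 0 ≤ c) :
    DilationBounded z C (fun s => c * f s) where
  cont := hf.cont.const_mul c
  bdd := by
    obtain ⟨A, hA⟩ := hf.bdd
    refine ⟨c * A, fun s => ?_⟩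
    rw [abs_mul, abs_of_nonneg hc]
    exact mul_le_mul_of_nonneg_left (hA s) hc
  le w := by
    simp only [mul_assoc]
    rw [integral_const_mul, integral_const_mul, mul_left_comm]
    exact mul_le_mul_of_nonneg_left (hf.le w) hc

lemma mul_cos (hf : DilationBounded z C f) (u : Fin d → ℝ) :
    DilationBounded z C (fun s => f s * Real.cos (∑ i, s i * u i)) where
  cont := by have := hf.cont; fun_prop
  bdd := by
    obtain ⟨B, hB⟩ := hf.bdd
    refine ⟨B * 1, fun s => ?_⟩
    rw [abs_mul]
    exact mul_le_mul (hB _) (Real.abs_cos_le_one _) (abs_nonneg _) ((abs_nonneg _).trans (hB 0))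
  le w := by
    have key : ∀ s : Fin d → ℝ, f s * Real.cos (∑ i, s i * u i) * Real.cos (∑ i, s i * w i)
        = 1 / 2 * (f s * Real.cos (∑ i, s i * (u + w) i)
          + f s * Real.cos (∑ i, s i * (u - w) i)) := by
      intro s
      simp only [Pi.add_apply, Pi.sub_apply, mul_add, mul_sub, Finset.sum_add_distrib,
        Finset.sum_sub_distrib, Real.cos_add, Real.cos_sub]
      ring
    simp only [key]
    rw [integral_const_mul, integral_const_mul,
      integral_add (hf.integrable z _) (hf.integrable z _),
      integral_add (hf.integrable' _) (hf.integrable' _)]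
    linarith [hf.le (u + w), hf.le (u - w)]

lemma mul_cos_pow (hf : DilationBounded z C f) (u : Fin d → ℝ) (n : ℕ) :
    DilationBounded z C (fun s => f s * Real.cos (∑ i, s i * u i) ^ n) := by
  induction n with
  | zero => simpa using hf
  | succ n ih =>
    simpa only [pow_succ, ← mul_assoc] using ih.mul_cos u

lemma mul_partial_exp (hf : DilationBounded z C f) (u : Fin d → ℝ) {c : ℝ} (hc : 0 ≤ c) (n : ℕ) :
    DilationBounded z C (fun s => f s *
      ∑ j ∈ Finset.range n, (c * Real.cos (∑ i, s i * u i)) ^ j / (j.factorial : ℝ)) := by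
  induction n with
  | zero => simpa using hf.const_mul le_rfl
  | succ n ih =>
    have h := ih.add ((hf.mul_cos_pow u n).const_mul
      (c := c ^ n / (n.factorial : ℝ)) (by positivity))
    refine cast ?_ h
    congr 1
    funext s
    rw [Finset.sum_range_succ, mul_add, mul_pow]
    ring

lemma mul_exp (hf : DilationBounded z C f) (u : Fin d → ℝ) {c : ℝ} (hc : 0 ≤ c) :
    DilationBounded z C (fun s => f s * Real.exp (c * Real.cos (∑ i, s i * u i))) := by
  obtain ⟨B, hB⟩ := hf.bdd
  have hB0 : 0 ≤ B := (abs_nonneg _).trans (hB 0)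
  have hcont := hf.cont
  have habs : ∀ s : Fin d → ℝ, |c * Real.cos (∑ i, s i * u i)| ≤ c := fun s => by
    rw [abs_mul, abs_of_nonneg hc]
    exact mul_le_of_le_one_right hc (Real.abs_cos_le_one _)
  have hlim : ∀ (b : ℝ) (w : Fin d → ℝ), Filter.Tendsto
      (fun n => ∫ s, f (b • s) * (∑ j ∈ Finset.range n,
          (c * Real.cos (∑ i, (b • s) i * u i)) ^ j / (j.factorial : ℝ))
        * Real.cos (∑ i, (b • s) i * w i) ∂triMeasure d) Filter.atTop
      (nhds (∫ s, f (b • s) * Real.exp (c * Real.cos (∑ i, (b • s) i * u i))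
        * Real.cos (∑ i, (b • s) i * w i) ∂triMeasure d)) := by
    intro b w
    refine tendsto_integral_of_dominated_convergence (fun _ => B * Real.exp c * 1) ?_
      (integrable_const _) ?_ ?_
    · intro n
      exact (Continuous.aestronglyMeasurable (by fun_prop))
    · intro n
      refine ae_of_all _ fun s => ?_
      rw [Real.norm_eq_abs, abs_mul, abs_mul]
      refine mul_le_mul (mul_le_mul (hB _) ?_ (abs_nonneg _) hB0) (Real.abs_cos_le_one _)
        (abs_nonneg _) (by positivity)
      refine (Finset.abs_sum_le_sum_abs _ _).trans ?_
      refine le_trans ?_ (Real.sum_le_exp_of_nonneg hc n)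
      refine Finset.sum_le_sum fun j _ => ?_
      rw [abs_div, abs_pow, abs_of_nonneg (Nat.cast_nonneg (j.factorial) : (0 : ℝ) ≤ _)]
      gcongr
      exact habs _
    · refine ae_of_all _ fun s => ?_
      refine Filter.Tendsto.mul_const _ (Filter.Tendsto.const_mul _ ?_)
      rw [Real.exp_eq_exp_ℝ]
      exact (NormedSpace.expSeries_div_hasSum_exp _).tendsto_sum_nat
  refine ⟨by fun_prop, ⟨B * Real.exp c, fun s => ?_⟩, fun w => ?_⟩
  · rw [abs_mul, Real.abs_exp]
    exact mul_le_mul (hB _) (Real.exp_le_exp.2 ((le_abs_self _).trans (habs s)))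
      (Real.exp_pos _).le hB0
  · have h1 := (hlim 1 w).const_mul C
    simp only [one_smul] at h1
    exact le_of_tendsto_of_tendsto' (hlim z w) h1 fun n => (hf.mul_partial_exp u hc n).le w

lemma mul_exp_sum {ι : Type*} (hf : DilationBounded z C f) (u : ι → Fin d → ℝ) {c : ℝ} (hc : 0 ≤ c)
    (t : Finset ι) :
    DilationBounded z C
      (fun s => f s * Real.exp (c * ∑ k ∈ t, Real.cos (∑ i, s i * u k i))) := by
  classical
  induction t using Finset.induction_on with
  | empty => simpa using hf
  | insert k t hk ih =>
    have h := ih.mul_exp (u k) hc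
    refine cast ?_ h
    congr 1
    funext s
    rw [Finset.sum_insert hk, mul_add, add_comm, Real.exp_add, mul_assoc]

end DilationBounded

/-- Dilating the characteristic function of a symmetric compound Poisson law by `z ≥ 1` increases
its integral over the unit cube by at most an exponential factor. -/
lemma integral_exp_cos_dilation_le {d n : ℕ} (u : Fin n → Fin d → ℝ) {c z : ℝ} (hc : 0 ≤ c)
    (hz : 1 ≤ z) :
    ∫ s, Real.exp (-(c * ∑ k, (1 - Real.cos (z * ∑ i, s i * u k i)))) ∂triMeasure d ≤
      80 ^ d * ∫ s, Real.exp (-(c * ∑ k, (1 - Real.cos (∑ i, s i * u k i)))) ∂triMeasure d := by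
  have h := (((DilationBounded.one (d := d) hz).mul_exp_sum u hc Finset.univ).const_mul
    (Real.exp_pos (-(c * n))).le).le 0
  simp only [Pi.zero_apply, mul_zero, Finset.sum_const_zero, Real.cos_zero, mul_one, one_mul,
    ← Real.exp_add] at h
  convert h using 5 with s
  · simp [Finset.mul_sum, mul_assoc, mul_sub]
    ring
  · simp
    ring

lemma integral_exp_neg_posDef {d : ℕ} {A : Matrix (Fin d) (Fin d) ℝ} (hA : A.PosDef) {c : ℝ}
    (hc : 0 < c) :
    Integrable (fun s : Fin d → ℝ => Real.exp (-c * (s ⬝ᵥ A.mulVec s))) ∧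
    ∫ s : Fin d → ℝ, Real.exp (-c * (s ⬝ᵥ A.mulVec s)) =
      Real.sqrt (Real.pi / c) ^ d * (1 / Real.sqrt A.det) := by
  open scoped MatrixOrder Matrix.Norms.L2Operator in
  obtain ⟨B, hB⟩ := CStarAlgebra.nonneg_iff_eq_star_mul_self.mp hA.posSemidef.nonneg
  have hdet : A.det = B.det ^ 2 := by
    rw [hB, Matrix.det_mul, Matrix.star_eq_conjTranspose, Matrix.det_conjTranspose]
    simp [sq]
  have hB0 : B.det ≠ 0 := fun h => hA.det_pos.ne' (by rw [hdet, h]; norm_num)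
  have hquad : ∀ s : Fin d → ℝ, s ⬝ᵥ A.mulVec s = ∑ i, (Matrix.toLin' B s i) ^ 2 := by
    intro s
    rw [hB, Matrix.star_eq_conjTranspose, ← Matrix.mulVec_mulVec, Matrix.dotProduct_mulVec,
      Matrix.conjTranspose_eq_transpose_of_trivial, Matrix.vecMul_transpose]
    simp [dotProduct, sq]
  have hprod : ∀ s : Fin d → ℝ, ∏ i, Real.exp (-c * (s i) ^ 2)
      = Real.exp (-c * ∑ i, (s i) ^ 2) := fun s => by
    rw [← Real.exp_sum, Finset.mul_sum]
  have hgint : Integrable (fun s : Fin d → ℝ => Real.exp (-c * ∑ i, (s i) ^ 2)) := by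
    have := Integrable.fintype_prod (fun _ : Fin d => integrable_exp_neg_mul_sq hc)
    rw [volume_pi]
    simpa only [hprod] using this
  have hgval : ∫ s : Fin d → ℝ, Real.exp (-c * ∑ i, (s i) ^ 2) = Real.sqrt (Real.pi / c) ^ d := by
    have := integral_fintype_prod_volume_eq_prod (fun (_ : Fin d) (t : ℝ) => Real.exp (-c * t ^ 2))
    simpa only [hprod, integral_gaussian, Finset.prod_const, Finset.card_univ,
      Fintype.card_fin] using this
  have hmap := Real.map_matrix_volume_pi_eq_smul_volume_pi hB0
  have hmeas : Measurable (Matrix.toLin' B) :=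
    (LinearMap.continuous_of_finiteDimensional _).measurable
  have hint' : Integrable (fun s : Fin d → ℝ => Real.exp (-c * ∑ i, (s i) ^ 2))
      (Measure.map (Matrix.toLin' B) volume) := by
    rw [hmap]
    exact hgint.smul_measure ENNReal.ofReal_ne_top
  simp only [hquad]
  refine ⟨hint'.comp_measurable hmeas, ?_⟩
  rw [← integral_map (f := fun s : Fin d → ℝ => Real.exp (-c * ∑ i, (s i) ^ 2))
    hmeas.aemeasurable hint'.1, hmap, integral_smul_measure, hgval, hdet, Real.sqrt_sq_eq_abs,
    ENNReal.toReal_ofReal (abs_nonneg _), abs_inv, smul_eq_mul]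
  ring

lemma one_sub_cos_nat_mul_le (m : ℕ) (x : ℝ) :
    1 - Real.cos (m * x) ≤ m ^ 2 * (1 - Real.cos x) := by
  have hs : ∀ (m : ℕ) (y : ℝ), |Real.sin (m * y)| ≤ m * |Real.sin y| := by
    intro m y
    induction m with
    | zero => simp
    | succ m ih =>
      push_cast
      rw [add_mul, one_mul, Real.sin_add]
      refine (abs_add_le _ _).trans ?_
      rw [abs_mul, abs_mul]
      nlinarith [mul_le_of_le_one_right (abs_nonneg (Real.sin (m * y))) (Real.abs_cos_le_one y),
        mul_le_of_le_one_left (abs_nonneg (Real.sin y)) (Real.abs_cos_le_one (m * y))]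
  have hc : ∀ y : ℝ, 1 - Real.cos y = 2 * |Real.sin (y / 2)| ^ 2 := by
    intro y
    rw [sq_abs, Real.sin_sq_eq_half_sub]
    ring_nf
  rw [hc, hc, mul_div_assoc]
  have h := pow_le_pow_left₀ (abs_nonneg _) (hs m (x / 2)) 2
  rw [mul_pow] at h
  linarith

lemma eight_mul_sq_le_one_sub_cos (y : ℝ) :
    8 * (y - round y) ^ 2 ≤ 1 - Real.cos (2 * Real.pi * y) := by
  have h1 : Real.cos (2 * Real.pi * y) = Real.cos (2 * (Real.pi * |y - round y|)) := by
    rw [← abs_of_pos Real.pi_pos, ← abs_mul, abs_of_pos Real.pi_pos]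
    have : 2 * |Real.pi * (y - round y)| = |2 * Real.pi * y - round y * (2 * Real.pi)| := by
      rw [← abs_two, ← abs_mul, abs_two]
      ring_nf
    rw [this, Real.cos_abs, Real.cos_sub_int_mul_two_pi]
  have hr := abs_sub_round y
  have hs := Real.mul_le_sin (x := Real.pi * |y - round y|) (by positivity)
    (by nlinarith [Real.pi_pos])
  have h2 : 2 / Real.pi * (Real.pi * |y - round y|) = 2 * |y - round y| := by
    field_simp
  rw [h2] at hs
  rw [h1, Real.cos_two_mul, Real.cos_sq', ← sq_abs (y - round y)]
  nlinarith [abs_nonneg (y - round y)]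

/-- Every scale can be replaced by one that is at least `1`, at the cost of a factor
comparable with `min (Z ^ 2) 1`. -/
lemma exists_dilation : ∃ ζ : ℝ → ℝ, Measurable ζ ∧ (∀ Z, 1 ≤ ζ Z) ∧
    ∀ Z x, min (Z ^ 2) 1 / 64 * (1 - Real.cos (ζ Z * (2 * Real.pi * x))) ≤
      1 - Real.cos (Z * x) := by
  have hpi := Real.pi_pos
  refine ⟨fun Z => max 1 (⌈2 * Real.pi / |Z|⌉₊ * |Z| / (2 * Real.pi)), ?_,
    fun Z => le_max_left _ _, fun Z x => ?_⟩
  · have h : Measurable fun Z : ℝ => ⌈2 * Real.pi / |Z|⌉₊ :=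
      Nat.measurable_ceil.comp (by fun_prop)
    have h' : Measurable fun Z : ℝ => (⌈2 * Real.pi / |Z|⌉₊ : ℝ) :=
      measurable_from_top.comp h
    fun_prop
  · rcases eq_or_ne Z 0 with rfl | hZ
    · simp
    beta_reduce
    have hZ' : 0 < |Z| := abs_pos.2 hZ
    set m := ⌈2 * Real.pi / |Z|⌉₊ with hm
    have hm1 : 2 * Real.pi / |Z| ≤ m := Nat.le_ceil _
    have hm2 : (m : ℝ) < 2 * Real.pi / |Z| + 1 := Nat.ceil_lt_add_one (by positivity)
    have hmZ : 2 * Real.pi ≤ m * |Z| := (div_le_iff₀ hZ').1 hm1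
    have hmZ2 : m * |Z| ≤ 2 * Real.pi + |Z| := by
      have := mul_le_mul_of_nonneg_right hm2.le hZ'.le
      rwa [add_mul, div_mul_cancel₀ _ hZ'.ne', one_mul] at this
    rw [max_eq_right ((one_le_div (by positivity)).2 hmZ)]
    have harg : m * |Z| / (2 * Real.pi) * (2 * Real.pi * x) = m * (|Z| * x) := by
      field_simp
    have hcos : Real.cos (|Z| * x) = Real.cos (Z * x) := by
      rcases abs_choice Z with h | h <;> rw [h]
      rw [neg_mul, Real.cos_neg]
    rw [harg]
    have key := one_sub_cos_nat_mul_le m (|Z| * x)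
    rw [hcos] at key
    have hw : min (Z ^ 2) 1 * m ^ 2 ≤ 64 := by
      have h8 : min |Z| 1 * m ≤ 8 := by
        rcases le_total |Z| 1 with h | h
        · rw [min_eq_left h, mul_comm]
          linarith [Real.pi_lt_d2]
        · rw [min_eq_right h, one_mul]
          have : 2 * Real.pi / |Z| ≤ 2 * Real.pi := div_le_self (by positivity) h
          linarith [Real.pi_lt_d2]
      have hsq : min (Z ^ 2) 1 = (min |Z| 1) ^ 2 := by
        rcases le_total |Z| 1 with h | h
        · rw [min_eq_left h, sq_abs, min_eq_left]
          rw [← sq_abs]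
          exact pow_le_one₀ hZ'.le h
        · rw [min_eq_right h, min_eq_right, one_pow]
          rw [← sq_abs]
          exact one_le_pow₀ h
      rw [hsq, ← mul_pow]
      have := pow_le_pow_left₀ (by positivity) h8 2
      linarith
    have hmin : 0 ≤ min (Z ^ 2) 1 := by positivity
    calc min (Z ^ 2) 1 / 64 * (1 - Real.cos (m * (|Z| * x)))
        ≤ min (Z ^ 2) 1 / 64 * (m ^ 2 * (1 - Real.cos (Z * x))) := by gcongr
      _ = min (Z ^ 2) 1 * m ^ 2 / 64 * (1 - Real.cos (Z * x)) := by ring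
      _ ≤ 1 * (1 - Real.cos (Z * x)) := by
        gcongr
        · linarith [Real.cos_le_one (Z * x)]
        · linarith
      _ = _ := one_mul _

lemma norm_charFun_sq (ν : Measure ℝ) [IsProbabilityMeasure ν] (t : ℝ) :
    ‖charFun ν t‖ ^ 2 = ∫ p : ℝ × ℝ, Real.cos (t * (p.1 - p.2)) ∂ν.prod ν := by
  have h1 : ((‖charFun ν t‖ ^ 2 : ℝ) : ℂ)
      = ∫ p : ℝ × ℝ, Complex.exp ((t * (p.1 - p.2) : ℝ) * Complex.I) ∂ν.prod ν := by
    rw [← Complex.normSq_eq_norm_sq, Complex.normSq_eq_conj_mul_self, ← charFun_neg, mul_comm,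
      charFun_apply_real, charFun_apply_real, ← integral_prod_mul]
    refine integral_congr_ae (ae_of_all _ fun p => ?_)
    simp only
    rw [← Complex.exp_add]
    push_cast
    ring_nf
  have hint : Integrable (fun p : ℝ × ℝ => Complex.exp ((t * (p.1 - p.2) : ℝ) * Complex.I))
      (ν.prod ν) :=
    Integrable.of_bound (Continuous.aestronglyMeasurable (by fun_prop)) 1
      (ae_of_all _ fun p => (Complex.norm_exp_ofReal_mul_I _).le)
  have h2 := congrArg Complex.re h1
  rw [Complex.ofReal_re, ← RCLike.re_eq_complex_re, ← integral_re hint] at h2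
  rw [h2]
  simp only [RCLike.re_eq_complex_re, Complex.exp_ofReal_mul_I_re]

lemma integrable_one_sub_cos (ν : Measure ℝ) [IsProbabilityMeasure ν] (t : ℝ) :
    Integrable (fun p : ℝ × ℝ => 1 - Real.cos (t * (p.1 - p.2))) (ν.prod ν) := by
  refine (integrable_const 1).sub ?_
  exact Integrable.of_bound (Continuous.aestronglyMeasurable (by fun_prop)) 1
    (ae_of_all _ fun p => Real.abs_cos_le_one _)

lemma norm_charFun_le (ν : Measure ℝ) [IsProbabilityMeasure ν] (t : ℝ) :
    ‖charFun ν t‖ ≤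
      Real.exp (-(1 / 2 * ∫ p : ℝ × ℝ, (1 - Real.cos (t * (p.1 - p.2))) ∂ν.prod ν)) := by
  have hcos : Integrable (fun p : ℝ × ℝ => Real.cos (t * (p.1 - p.2))) (ν.prod ν) :=
    Integrable.of_bound (Continuous.aestronglyMeasurable (by fun_prop)) 1
      (ae_of_all _ fun p => Real.abs_cos_le_one _)
  have h : ∫ p : ℝ × ℝ, (1 - Real.cos (t * (p.1 - p.2))) ∂ν.prod ν = 1 - ‖charFun ν t‖ ^ 2 := by
    rw [integral_sub (integrable_const 1) hcos, norm_charFun_sq]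
    simp
  rw [h]
  refine le_of_sq_le_sq ?_ (Real.exp_pos _).le
  rw [← Real.exp_nat_mul]
  have := Real.add_one_le_exp (‖charFun ν t‖ ^ 2 - 1)
  refine le_trans (by linarith) (this.trans_eq ?_)
  congr 1
  push_cast
  ring

lemma integral_cos_sum_le {n : ℕ} (ν : Measure ℝ) [IsProbabilityMeasure ν] (y : Fin n → ℝ)
    (θ : ℝ) :
    ∫ ω, Real.cos (∑ k, ω k * y k - θ) ∂Measure.pi (fun _ : Fin n => ν) ≤
      ∏ k, ‖charFun ν (y k)‖ := by
  have hp : ∀ ω : Fin n → ℝ, Complex.exp ((∑ k, ω k * y k - θ : ℝ) * Complex.I)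
      = Complex.exp (-θ * Complex.I) * ∏ k, Complex.exp (y k * ω k * Complex.I) := by
    intro ω
    rw [← Complex.exp_sum, ← Complex.exp_add, ← Finset.sum_mul]
    push_cast
    simp only [mul_comm (y _ : ℂ)]
    ring_nf
  have hint : Integrable (fun ω : Fin n → ℝ =>
      Complex.exp ((∑ k, ω k * y k - θ : ℝ) * Complex.I)) (Measure.pi (fun _ : Fin n => ν)) :=
    Integrable.of_bound (Continuous.aestronglyMeasurable (by fun_prop)) 1
      (ae_of_all _ fun p => (Complex.norm_exp_ofReal_mul_I _).le)
  have hval : ∫ ω, Complex.exp ((∑ k, ω k * y k - θ : ℝ) * Complex.I)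
      ∂Measure.pi (fun _ : Fin n => ν) = Complex.exp (-θ * Complex.I) * ∏ k, charFun ν (y k) := by
    simp only [hp]
    rw [integral_const_mul, integral_fintype_prod_eq_prod (𝕜 := ℂ)
      (fun k (t : ℝ) => Complex.exp (y k * t * Complex.I))]
    simp only [charFun_apply_real]
  have h2 := congrArg Complex.re hval
  rw [← RCLike.re_eq_complex_re, ← integral_re hint] at h2
  simp only [RCLike.re_eq_complex_re, Complex.exp_ofReal_mul_I_re] at h2
  rw [h2]
  refine (Complex.re_le_norm _).trans ?_
  rw [norm_mul, ← Complex.ofReal_neg, Complex.norm_exp_ofReal_mul_I, one_mul, norm_prod]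

/-- A smoothing inequality in the spirit of Esseen. -/
lemma integral_prod_triSqHat_le {d n : ℕ} (ν : Measure ℝ) [IsProbabilityMeasure ν]
    (b : Fin n → Fin d → ℝ) (v : Fin d → ℝ) :
    ∫ ω, ∏ i, triSqHat (∑ k, ω k * b k i - v i) ∂Measure.pi (fun _ : Fin n => ν) ≤
      ∫ s, ∏ k, ‖charFun ν (∑ i, s i * b k i)‖ ∂triMeasure d := by
  simp only [← integral_cos_triMeasure]
  have hint : Integrable (Function.uncurry fun (ω : Fin n → ℝ) (s : Fin d → ℝ) =>
      Real.cos (∑ i, s i * (∑ k, ω k * b k i - v i)))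
      ((Measure.pi (fun _ : Fin n => ν)).prod (triMeasure d)) := by
    refine Integrable.of_bound (Continuous.aestronglyMeasurable ?_) 1
      (ae_of_all _ fun p => Real.abs_cos_le_one _)
    simp only [Function.uncurry_def]
    fun_prop
  rw [integral_integral_swap hint]
  refine integral_mono hint.integral_prod_right ?_ fun s => ?_
  · refine integrable_triMeasure_of_bdd (B := 1) ?_ fun s => ?_
    · have : Continuous (charFun ν) := by fun_prop
      fun_prop
    · rw [abs_of_nonneg (Finset.prod_nonneg fun _ _ => norm_nonneg _)]
      exact Finset.prod_le_one (fun _ _ => norm_nonneg _) fun _ _ => norm_charFun_le_one _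
  · have h := integral_cos_sum_le ν (fun k => ∑ i, s i * b k i) (∑ i, s i * v i)
    refine le_of_eq_of_le ?_ h
    congr 1
    funext ω
    congr 1
    simp only [mul_sub, Finset.sum_sub_distrib, Finset.mul_sum]
    rw [Finset.sum_comm]
    congr 1
    refine Finset.sum_congr rfl fun k _ => Finset.sum_congr rfl fun i _ => by ring

lemma integrable_min_sq (ν : Measure ℝ) [IsProbabilityMeasure ν] (τ : ℝ) :
    Integrable (fun p : ℝ × ℝ => min ((p.1 - p.2) ^ 2 / τ ^ 2) 1) (ν.prod ν) := by
  refine Integrable.of_bound (Continuous.aestronglyMeasurable (by fun_prop)) 1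
    (ae_of_all _ fun p => ?_)
  rw [Real.norm_eq_abs, abs_of_nonneg (by positivity)]
  exact min_le_right _ _

/-- The law of `(X₁, X₂)` reweighted by `min (X̃² / τ²) 1`. -/
noncomputable def truncLaw (ν : Measure ℝ) (τ : ℝ) : Measure (ℝ × ℝ) :=
  (ν.prod ν).withDensity fun p =>
    ENNReal.ofReal (min ((p.1 - p.2) ^ 2 / τ ^ 2) 1 / Mfn ν τ)

lemma measurable_truncLaw_density (ν : Measure ℝ) (τ : ℝ) :
    Measurable fun p : ℝ × ℝ => min ((p.1 - p.2) ^ 2 / τ ^ 2) 1 / Mfn ν τ := by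
  fun_prop

lemma integral_truncLaw {ν : Measure ℝ} {τ : ℝ} (hM : 0 < Mfn ν τ)
    (f : ℝ × ℝ → ℝ) :
    Mfn ν τ * ∫ p, f p ∂truncLaw ν τ
      = ∫ p : ℝ × ℝ, min ((p.1 - p.2) ^ 2 / τ ^ 2) 1 * f p ∂ν.prod ν := by
  unfold truncLaw
  rw [integral_withDensity_eq_integral_toReal_smul
    (measurable_truncLaw_density ν τ).ennreal_ofReal (by simp), ← integral_const_mul]
  refine integral_congr_ae (ae_of_all _ fun p => ?_)
  simp only [smul_eq_mul]
  rw [ENNReal.toReal_ofReal (by positivity)]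
  field_simp

lemma isProbabilityMeasure_truncLaw {ν : Measure ℝ} [IsProbabilityMeasure ν] {τ : ℝ}
    (hM : 0 < Mfn ν τ) : IsProbabilityMeasure (truncLaw ν τ) := by
  constructor
  unfold truncLaw
  rw [withDensity_apply _ MeasurableSet.univ, Measure.restrict_univ,
    ← ofReal_integral_eq_lintegral_ofReal ((integrable_min_sq ν τ).div_const _)
      (ae_of_all _ fun p => by positivity), integral_div]
  change ENNReal.ofReal (Mfn ν τ / Mfn ν τ) = 1
  rw [div_self hM.ne', ENNReal.ofReal_one]

/-- Exponent of the dilated compound Poisson characteristic function. -/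
noncomputable def cosDefect {d n : ℕ} (b : Fin n → Fin d → ℝ) (ζ : ℝ → ℝ) (τ : ℝ)
    (s : Fin d → ℝ) (p : ℝ × ℝ) : ℝ :=
  ∑ k, (1 - Real.cos (ζ ((p.1 - p.2) / τ) * (2 * Real.pi * ∑ i, s i * b k i)))

lemma measurable_cosDefect {d n : ℕ} (b : Fin n → Fin d → ℝ) {ζ : ℝ → ℝ} (hζ : Measurable ζ)
    (τ : ℝ) : Measurable (Function.uncurry (cosDefect b ζ τ)) := by
  unfold cosDefect Function.uncurry
  refine Finset.measurable_sum _ fun k _ => ?_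
  have h1 : Measurable fun q : (Fin d → ℝ) × ℝ × ℝ => ζ ((q.2.1 - q.2.2) / τ) :=
    hζ.comp (by fun_prop)
  have h2 : Measurable fun q : (Fin d → ℝ) × ℝ × ℝ => 2 * Real.pi * ∑ i, q.1 i * b k i :=
    Continuous.measurable (by fun_prop)
  exact (Real.measurable_cos.comp (h1.mul h2)).const_sub 1

lemma cosDefect_nonneg {d n : ℕ} (b : Fin n → Fin d → ℝ) (ζ : ℝ → ℝ) (τ : ℝ)
    (s : Fin d → ℝ) (p : ℝ × ℝ) : 0 ≤ cosDefect b ζ τ s p :=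
  Finset.sum_nonneg fun _ _ => sub_nonneg.2 (Real.cos_le_one _)

lemma cosDefect_le {d n : ℕ} (b : Fin n → Fin d → ℝ) (ζ : ℝ → ℝ) (τ : ℝ)
    (s : Fin d → ℝ) (p : ℝ × ℝ) : cosDefect b ζ τ s p ≤ n * 2 := by
  have h : cosDefect b ζ τ s p ≤ ∑ _k : Fin n, (2 : ℝ) :=
    Finset.sum_le_sum fun k _ => by
      have := Real.neg_one_le_cos (ζ ((p.1 - p.2) / τ) * (2 * Real.pi * ∑ i, s i * b k i))
      linarith
  simpa using h

/-- The product of characteristic functions is dominated, on average, by the characteristic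
function of a symmetric compound Poisson law. -/
lemma integral_prod_norm_charFun_le {d n : ℕ} {ν : Measure ℝ} [IsProbabilityMeasure ν] {τ : ℝ}
    (hτ : 0 < τ) (hM : 0 < Mfn ν τ) (b : Fin n → Fin d → ℝ) :
    ∫ s, ∏ k, ‖charFun ν (∑ i, s i * (b k i / τ))‖ ∂triMeasure d ≤
      80 ^ d * ∫ s, Real.exp (-(Mfn ν τ / 128 *
        ∑ k, (1 - Real.cos (2 * Real.pi * ∑ i, s i * b k i)))) ∂triMeasure d := by
  obtain ⟨ζ, hζm, hζ1, hζ⟩ := exists_dilation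
  have hprob := isProbabilityMeasure_truncLaw hM
  set M := Mfn ν τ with hMdef
  have hgm := measurable_cosDefect b hζm τ
  have hg0 := cosDefect_nonneg b ζ τ
  have hg2 := cosDefect_le b ζ τ
  generalize hg : cosDefect b ζ τ = g at hgm hg0 hg2
  have hgms : ∀ s, Measurable (g s) := fun s => hgm.of_uncurry_left
  have hgi : ∀ s (μ : Measure (ℝ × ℝ)) [IsFiniteMeasure μ], Integrable (g s) μ := fun s μ _ =>
    Integrable.of_bound (hgms s).aestronglyMeasurable _ (ae_of_all _ fun p => by
      rw [Real.norm_eq_abs, abs_of_nonneg (hg0 s p)]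
      exact hg2 s p)
  have hexp1 : ∀ s p, |Real.exp (-(M / 128 * g s p))| ≤ 1 := fun s p => by
    rw [Real.abs_exp, Real.exp_le_one_iff, neg_nonpos]
    exact mul_nonneg (by positivity) (hg0 s p)
  have hei : ∀ s, Integrable (fun p => Real.exp (-(M / 128 * g s p))) (truncLaw ν τ) := fun s =>
    Integrable.of_bound (by have := hgms s; exact Measurable.aestronglyMeasurable (by fun_prop)) 1
      (ae_of_all _ fun p => hexp1 s p)
  have hint : Integrable (Function.uncurry fun s p => Real.exp (-(M / 128 * g s p)))
      ((triMeasure d).prod (truncLaw ν τ)) := by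
    refine Integrable.of_bound (Measurable.aestronglyMeasurable ?_) 1
      (ae_of_all _ fun q => hexp1 q.1 q.2)
    exact Real.measurable_exp.comp (hgm.const_mul _).neg
  have hpt : ∀ s, ∏ k, ‖charFun ν (∑ i, s i * (b k i / τ))‖ ≤
      ∫ p, Real.exp (-(M / 128 * g s p)) ∂truncLaw ν τ := by
    intro s
    have hx : ∀ k, ∑ i, s i * (b k i / τ) = (∑ i, s i * b k i) / τ := fun k => by
      rw [Finset.sum_div]
      exact Finset.sum_congr rfl fun i _ => by ring
    have hjensen := (convexOn_exp).map_integral_le (μ := truncLaw ν τ)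
      (f := fun p => -(M / 128 * g s p)) Real.continuous_exp.continuousOn isClosed_univ
      (ae_of_all _ fun _ => Set.mem_univ _) ((hgi s _).const_mul _).neg (hei s)
    refine le_trans ?_ hjensen
    calc ∏ k, ‖charFun ν (∑ i, s i * (b k i / τ))‖
        ≤ ∏ k, Real.exp (-(1 / 2 * ∫ p : ℝ × ℝ,
            (1 - Real.cos (((∑ i, s i * b k i) / τ) * (p.1 - p.2))) ∂ν.prod ν)) := by
          refine Finset.prod_le_prod (fun _ _ => norm_nonneg _) fun k _ => ?_
          rw [hx]
          exact norm_charFun_le ν _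
      _ = Real.exp (-(1 / 2 * ∫ p : ℝ × ℝ, ∑ k,
            (1 - Real.cos (((∑ i, s i * b k i) / τ) * (p.1 - p.2))) ∂ν.prod ν)) := by
          rw [integral_finsetSum _ fun k _ => integrable_one_sub_cos ν _, ← Real.exp_sum,
            Finset.mul_sum, Finset.sum_neg_distrib]
      _ ≤ Real.exp (-(1 / 2 * ∫ p : ℝ × ℝ,
            min ((p.1 - p.2) ^ 2 / τ ^ 2) 1 * (1 / 64 * g s p) ∂ν.prod ν)) := by
          rw [Real.exp_le_exp, neg_le_neg_iff]
          refine mul_le_mul_of_nonneg_left (integral_mono_of_nonneg ?_ ?_ ?_) (by norm_num)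
          · exact ae_of_all _ fun p => mul_nonneg (by positivity)
              (mul_nonneg (by norm_num) (hg0 s p))
          · exact integrable_finsetSum _ fun k _ => integrable_one_sub_cos ν _
          · refine ae_of_all _ fun p => ?_
            simp only [← hg, cosDefect]
            rw [Finset.mul_sum, Finset.mul_sum]
            refine Finset.sum_le_sum fun k _ => ?_
            have h := hζ ((p.1 - p.2) / τ) (∑ i, s i * b k i)
            rw [div_pow] at h
            refine le_trans (le_of_eq (by ring)) (h.trans (le_of_eq ?_))
            congr 2
            ring
      _ = Real.exp (∫ p, -(M / 128 * g s p) ∂truncLaw ν τ) := by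
          rw [← integral_truncLaw hM, integral_neg, integral_const_mul, integral_const_mul]
          congr 1
          ring
  calc ∫ s, ∏ k, ‖charFun ν (∑ i, s i * (b k i / τ))‖ ∂triMeasure d
      ≤ ∫ s, ∫ p, Real.exp (-(M / 128 * g s p)) ∂truncLaw ν τ ∂triMeasure d :=
        integral_mono_of_nonneg
          (ae_of_all _ fun s => Finset.prod_nonneg fun _ _ => norm_nonneg _)
          hint.integral_prod_left (ae_of_all _ hpt)
    _ = ∫ p, ∫ s, Real.exp (-(M / 128 * g s p)) ∂triMeasure d ∂truncLaw ν τ :=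
        integral_integral_swap hint
    _ ≤ ∫ _p, 80 ^ d * ∫ s, Real.exp (-(M / 128 *
        ∑ k, (1 - Real.cos (2 * Real.pi * ∑ i, s i * b k i)))) ∂triMeasure d ∂truncLaw ν τ := by
        refine integral_mono hint.integral_prod_right (integrable_const _) fun p => ?_
        have h := integral_exp_cos_dilation_le (fun k i => 2 * Real.pi * b k i)
          (c := M / 128) (by positivity) (hζ1 ((p.1 - p.2) / τ))
        have hr : ∀ (s : Fin d → ℝ) k, ∑ i, s i * (2 * Real.pi * b k i)
            = 2 * Real.pi * ∑ i, s i * b k i := fun s k => by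
          rw [Finset.mul_sum]
          exact Finset.sum_congr rfl fun i _ => by ring
        simpa only [hr, ← hg, cosDefect] using h
    _ = _ := by simp

/-- Lower bound for the smoothing kernel near the origin. -/
lemma one_le_prod_triSqHat {d : ℕ} (x : Fin d → ℝ) (hx : ∑ i, x i ^ 2 ≤ d) :
    1 ≤ (5 * Real.exp 1) ^ d * ∏ i, triSqHat (x i) := by
  have h1 : ∏ i, (1 + x i ^ 2) ≤ Real.exp 1 ^ d := by
    calc ∏ i, (1 + x i ^ 2) ≤ ∏ i, Real.exp (x i ^ 2) :=
          Finset.prod_le_prod (fun i _ => by positivity) fun i _ => by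
            linarith [Real.add_one_le_exp (x i ^ 2)]
      _ = Real.exp (∑ i, x i ^ 2) := (Real.exp_sum _ _).symm
      _ ≤ Real.exp (d * 1) := Real.exp_le_exp.2 (by linarith)
      _ = Real.exp 1 ^ d := by rw [Real.exp_nat_mul]
  have h2 : (1 : ℝ) ≤ ∏ i, (5 * triSqHat (x i) * (1 + x i ^ 2)) := by
    refine le_of_eq_of_le (Finset.prod_const_one (ι := Fin d) (s := Finset.univ)).symm ?_
    refine Finset.prod_le_prod (fun _ _ => zero_le_one) fun i _ => ?_
    have := (triSqHat_bounds (x i)).1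
    rw [div_le_iff₀ (by positivity)] at this
    linarith
  rw [Finset.prod_mul_distrib, Finset.prod_mul_distrib] at h2
  simp only [Finset.prod_const, Finset.card_univ, Fintype.card_fin] at h2
  have h3 : 0 ≤ (5 : ℝ) ^ d * ∏ i, triSqHat (x i) :=
    mul_nonneg (by positivity) (Finset.prod_nonneg fun i _ => (triSqHat_pos _).le)
  rw [mul_pow]
  nlinarith [mul_le_mul_of_nonneg_left h1 h3]

lemma continuous_triSqHat : Continuous triSqHat := by
  unfold triSqHat
  refine continuous_of_dominated (bound := triSq) (fun x => ?_) (fun x => ae_of_all _ fun s => ?_)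
    integrable_triSq (ae_of_all _ fun s => by fun_prop)
  · have := continuous_triSq
    exact (Continuous.aestronglyMeasurable (by fun_prop))
  · rw [Real.norm_eq_abs, abs_mul, abs_of_nonneg (triSq_nonneg s)]
    exact mul_le_of_le_one_right (triSq_nonneg s) (Real.abs_cos_le_one _)

lemma triSqHat_le (x : ℝ) : triSqHat x ≤ 16 :=
  (triSqHat_bounds x).2.trans (div_le_self (by norm_num) (by linarith [sq_nonneg x]))

/-- Bound of the concentration function by an integral of characteristic functions. -/
lemma concFn_sumLaw_le {d n : ℕ} (hd : 0 < d) {ν : Measure ℝ} [IsProbabilityMeasure ν] {τ D : ℝ}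
    (hτ : 0 < τ) (hD : 0 < D) (a : Fin n → EuclideanSpace ℝ (Fin d)) :
    concFn (sumLaw ν a) (d * τ / D) ≤ (5 * Real.exp 1) ^ d *
      ∫ s, ∏ k, ‖charFun ν (∑ i, s i * (D / Real.sqrt d * a k i / τ))‖ ∂triMeasure d := by
  have hd' : (0 : ℝ) < d := Nat.cast_pos.2 hd
  refine ciSup_le fun v => ?_
  set κ := D / Real.sqrt d / τ with hκ
  have hκ0 : 0 < κ := by positivity
  set F : (Fin n → ℝ) → ℝ := fun ω => (5 * Real.exp 1) ^ d *
    ∏ i, triSqHat (∑ k, ω k * (D / Real.sqrt d * a k i / τ) - κ * v i) with hF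
  have hmeas : Measurable fun ω : Fin n → ℝ => ∑ k, ω k • a k := by fun_prop
  have hF0 : ∀ ω, 0 ≤ F ω := fun ω =>
    mul_nonneg (by positivity) (Finset.prod_nonneg fun i _ => (triSqHat_pos _).le)
  have hFint : Integrable F (Measure.pi fun _ : Fin n => ν) := by
    refine Integrable.of_bound (Continuous.aestronglyMeasurable ?_)
      ((5 * Real.exp 1) ^ d * ∏ _i : Fin d, 16) (ae_of_all _ fun ω => ?_)
    · have := continuous_triSqHat
      fun_prop
    · rw [Real.norm_eq_abs, abs_of_nonneg (hF0 ω)]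
      exact mul_le_mul_of_nonneg_left (Finset.prod_le_prod (fun i _ => (triSqHat_pos _).le)
        fun i _ => triSqHat_le _) (by positivity)
  have hsub : (fun ω : Fin n → ℝ => ∑ k, ω k • a k) ⁻¹' Metric.closedBall v (d * τ / D)
      ⊆ {ω | 1 ≤ F ω} := by
    intro ω hω
    rw [Set.mem_preimage, mem_closedBall_iff_norm] at hω
    refine one_le_prod_triSqHat _ ?_
    have hcoord : ∀ i, ∑ k, ω k * (D / Real.sqrt d * a k i / τ) - κ * v i
        = κ * (∑ k, ω k • a k - v) i := fun i => by
      simp only [PiLp.sub_apply, WithLp.ofLp_sum, WithLp.ofLp_smul, Finset.sum_apply,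
        Pi.smul_apply, smul_eq_mul, mul_sub, Finset.mul_sum, hκ]
      congr 1
      exact Finset.sum_congr rfl fun k _ => by ring
    simp only [hcoord, mul_pow, ← Finset.mul_sum]
    rw [← EuclideanSpace.real_norm_sq_eq]
    have h1 := pow_le_pow_left₀ (norm_nonneg _) hω 2
    have h2 : κ ^ 2 * (d * τ / D) ^ 2 = d := by
      rw [hκ, div_pow, div_pow, Real.sq_sqrt hd'.le]
      field_simp
    nlinarith [sq_nonneg κ, mul_le_mul_of_nonneg_left h1 (sq_nonneg κ)]
  rw [sumLaw, Measure.map_apply hmeas Metric.isClosed_closedBall.measurableSet]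
  have hmarkov := mul_meas_ge_le_integral_of_nonneg (ae_of_all _ hF0) hFint 1
  rw [one_mul] at hmarkov
  refine (measureReal_mono hsub).trans (hmarkov.trans ?_)
  rw [hF, integral_const_mul]
  exact mul_le_mul_of_nonneg_left (integral_prod_triSqHat_le ν _ _) (by positivity)

lemma dotProduct_covMat_mulVec {d n : ℕ} (a : Fin n → EuclideanSpace ℝ (Fin d)) (s : Fin d → ℝ) :
    s ⬝ᵥ (covMat a).mulVec s = ∑ k, (∑ i, s i * a k i) ^ 2 := by
  simp only [dotProduct, Matrix.mulVec, covMat, Matrix.of_apply, sq, Finset.sum_mul_sum]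
  rw [Finset.sum_comm]
  refine Finset.sum_congr rfl fun i _ => ?_
  rw [Finset.sum_comm, Finset.mul_sum]
  refine Finset.sum_congr rfl fun j _ => ?_
  rw [Finset.sum_mul, Finset.mul_sum]
  exact Finset.sum_congr rfl fun k _ => by ring

/-- The arithmetic hypothesis makes the compound Poisson characteristic function Gaussian-like on
the cube, up to a small error. -/
lemma integral_exp_cos_le {d n : ℕ} (hd : 0 < d) (a : Fin n → EuclideanSpace ℝ (Fin d))
    (ha : (covMat a).PosDef) {D α M : ℝ} (hD : 0 < D) (hM : 0 < M)
    (h : ∀ (m : Fin n → ℤ) (t : EuclideanSpace ℝ (Fin d)),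
        ‖t‖ ≤ D → (∃ k, (1 / 2 : ℝ) ≤ |⟪t, a k⟫|) →
        α ^ 2 ≤ ∑ k, (⟪t, a k⟫ - m k) ^ 2) :
    ∫ s, Real.exp (-(M / 128 * ∑ k, (1 - Real.cos (2 * Real.pi *
        ∑ i, s i * (D / Real.sqrt d * a k i))))) ∂triMeasure d ≤
      8 ^ d * ((Real.sqrt d / (D * Real.sqrt M)) ^ d * (1 / Real.sqrt (covMat a).det)
        + Real.exp (-(1 / 16) * α ^ 2 * M)) := by
  have hd' : (0 : ℝ) < d := Nat.cast_pos.2 hd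
  set c := M / 16 * (D ^ 2 / d) with hc
  have hc0 : 0 < c := by positivity
  obtain ⟨hGint, hGval⟩ := integral_exp_neg_posDef ha hc0
  have hin : ∀ (s : Fin d → ℝ) k, ⟪WithLp.toLp 2 ((D / Real.sqrt d) • s), a k⟫
      = ∑ i, s i * (D / Real.sqrt d * a k i) := fun s k => by
    simp only [PiLp.inner_apply, Pi.smul_apply, smul_eq_mul, RCLike.inner_apply, conj_trivial]
    exact Finset.sum_congr rfl fun i _ => by ring
  have hpt : ∀ s : Fin d → ℝ, (∀ i, |s i| ≤ 1) →
      Real.exp (-(M / 128 * ∑ k, (1 - Real.cos (2 * Real.pi *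
        ∑ i, s i * (D / Real.sqrt d * a k i))))) ≤
      Real.exp (-(1 / 16) * α ^ 2 * M) + Real.exp (-c * (s ⬝ᵥ (covMat a).mulVec s)) := by
    intro s hs
    set t : EuclideanSpace ℝ (Fin d) := WithLp.toLp 2 ((D / Real.sqrt d) • s) with ht
    have htD : ‖t‖ ≤ D := by
      have h1 : ‖t‖ ^ 2 ≤ D ^ 2 := by
        rw [EuclideanSpace.real_norm_sq_eq]
        simp only [ht, Pi.smul_apply, smul_eq_mul, mul_pow, div_pow, Real.sq_sqrt hd'.le]
        calc ∑ i, D ^ 2 / d * s i ^ 2 ≤ ∑ _i : Fin d, D ^ 2 / d :=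
              Finset.sum_le_sum fun i _ => mul_le_of_le_one_right (by positivity)
                ((sq_le_one_iff_abs_le_one _).2 (hs i))
          _ = D ^ 2 := by
              simp only [Finset.sum_const, Finset.card_univ, Fintype.card_fin, nsmul_eq_mul]
              field_simp
      exact le_of_sq_le_sq h1 hD.le
    have hlow : M / 16 * ∑ k, (⟪t, a k⟫ - round ⟪t, a k⟫) ^ 2 ≤
        M / 128 * ∑ k, (1 - Real.cos (2 * Real.pi * ⟪t, a k⟫)) := by
      rw [Finset.mul_sum, Finset.mul_sum]
      refine Finset.sum_le_sum fun k _ => ?_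
      nlinarith [mul_le_mul_of_nonneg_left (eight_mul_sq_le_one_sub_cos ⟪t, a k⟫) hM.le]
    simp only [← hin]
    by_cases hk : ∃ k, (1 / 2 : ℝ) ≤ |⟪t, a k⟫|
    · refine le_add_of_le_of_nonneg (Real.exp_le_exp.2 ?_) (Real.exp_pos _).le
      have := mul_le_mul_of_nonneg_left (h (fun k => round ⟪t, a k⟫) t htD hk) hM.le
      linarith
    · push Not at hk
      refine le_add_of_nonneg_of_le (Real.exp_pos _).le (Real.exp_le_exp.2 ?_)
      have hround : ∀ k, round ⟪t, a k⟫ = 0 := fun k => by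
        have := abs_lt.1 (hk k)
        rw [round_eq_zero_iff]
        exact ⟨by linarith, by linarith⟩
      have hq : c * (s ⬝ᵥ (covMat a).mulVec s)
          = M / 16 * ∑ k, (⟪t, a k⟫ - round ⟪t, a k⟫) ^ 2 := by
        simp only [hround, Int.cast_zero, sub_zero, dotProduct_covMat_mulVec, hc, mul_assoc]
        congr 1
        rw [Finset.mul_sum]
        refine Finset.sum_congr rfl fun k _ => ?_
        have : ⟪t, a k⟫ = D / Real.sqrt d * ∑ i, s i * a k i := by
          rw [hin, Finset.mul_sum]
          exact Finset.sum_congr rfl fun i _ => by ring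
        rw [this, mul_pow, div_pow, Real.sq_sqrt hd'.le]
      rw [neg_mul, hq]
      exact neg_le_neg hlow
  have hGint' := hGint.mono_measure (triMeasure_le_volume d)
  calc _ ≤ ∫ s, (Real.exp (-(1 / 16) * α ^ 2 * M)
          + Real.exp (-c * (s ⬝ᵥ (covMat a).mulVec s))) ∂triMeasure d := by
        refine integral_mono_of_nonneg (ae_of_all _ fun s => (Real.exp_pos _).le)
          ((integrable_const _).add hGint') ?_
        filter_upwards [ae_triMeasure_abs_le_one d] with s hs using hpt s hs
    _ ≤ Real.exp (-(1 / 16) * α ^ 2 * M)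
          + Real.sqrt (Real.pi / c) ^ d * (1 / Real.sqrt (covMat a).det) := by
        rw [integral_add (integrable_const _) hGint', integral_const, smul_eq_mul]
        refine add_le_add
          (mul_le_of_le_one_left (Real.exp_pos _).le (triMeasure_univ_le_one d)) ?_
        rw [← hGval]
        exact integral_mono_measure (triMeasure_le_volume d)
          (ae_of_all _ fun s => (Real.exp_pos _).le) hGint
    _ ≤ _ := by
        have h8 : Real.sqrt (Real.pi / c) ≤ 8 * (Real.sqrt d / (D * Real.sqrt M)) := by
          rw [Real.sqrt_le_left (by positivity)]
          rw [mul_pow, div_pow, mul_pow, Real.sq_sqrt hd'.le, Real.sq_sqrt hM.le, hc]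
          rw [show Real.pi / (M / 16 * (D ^ 2 / d)) = 16 * Real.pi * (d / (D ^ 2 * M)) by
            field_simp]
          have := Real.pi_lt_four
          gcongr
          linarith
        have hpow := pow_le_pow_left₀ (Real.sqrt_nonneg _) h8 d
        rw [mul_pow] at hpow
        have h1 : (1 : ℝ) ≤ 8 ^ d := one_le_pow₀ (by norm_num)
        rw [mul_add, add_comm, ← mul_assoc]
        refine add_le_add (mul_le_mul_of_nonneg_right hpow (by positivity)) ?_
        exact le_mul_of_one_le_left (Real.exp_pos _).le h1

theorem stmt_2 :
    ∃ c₁ c₂ : ℝ, 0 < c₁ ∧ 0 < c₂ ∧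
      ∀ (d n : ℕ), 0 < d →
      ∀ (ν : Measure ℝ), IsProbabilityMeasure ν →
      ∀ τ : ℝ, 0 < τ → 0 < Mfn ν τ →
      ∀ (a : Fin n → EuclideanSpace ℝ (Fin d)),
      (covMat a).PosDef →
      ∀ D α : ℝ, 0 < D → 0 < α →
      (∀ (m : Fin n → ℤ) (t : EuclideanSpace ℝ (Fin d)),
        ‖t‖ ≤ D → (∃ k, (1 / 2 : ℝ) ≤ |⟪t, a k⟫|) →
        α ^ 2 ≤ ∑ k, (⟪t, a k⟫ - m k) ^ 2) →
      concFn (sumLaw ν a) (d * τ / D) ≤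
        c₁ ^ d * ((Real.sqrt d / (D * Real.sqrt (Mfn ν τ))) ^ d
            * (1 / Real.sqrt (covMat a).det)
          + Real.exp (-c₂ * α ^ 2 * Mfn ν τ)) := by
  refine ⟨5 * Real.exp 1 * 80 * 8, 1 / 16, by positivity, by norm_num, ?_⟩
  intro d n hd ν hν τ hτ hM a ha D α hD hα h
  refine (concFn_sumLaw_le hd hτ hD a).trans ?_
  have h1 := integral_prod_norm_charFun_le hτ hM (fun k i => D / Real.sqrt d * a k i)
  have h2 := integral_exp_cos_le hd a ha hD hM h
  rw [mul_pow _ (8 : ℝ), mul_pow _ (80 : ℝ), mul_assoc, mul_assoc]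
  refine mul_le_mul_of_nonneg_left (h1.trans ?_) (by positivity)
  exact mul_le_mul_of_nonneg_left h2 (by positivity)
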